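/- arXiv:2508.07156 — 2 statements merged into one kernel-verified Lean document; each statement's English description precedes it below -/
import Mathlib

section
/- (Polynomial case of Lemma 3.9.) Let d ≥ 2, let a ∈ O_L and u ∈ L with ‖u‖ = 1, and let φ(X) = a + u·(X − a)^d, so that φ is a degree-d polynomial with good reduction having a totally ramified fixed point at a. Then ev_a is the unique fixed point of φ in the open Berkovich disk of the direction of a at the Gauss point: ev_a ∈ Fix(φ), and any x ∈ Fix(φ) with x(X − a) < 1 equals ev_a. -/
open Polynomial

/-- A point of the Berkovich affine line `A¹_an` over `L`: a multiplicative ring seminorm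
on `L[X]` whose restriction to the constant polynomials is the given absolute value of `L`. -/
structure BerkovichPoint (L : Type*) [NontriviallyNormedField L] where
  toFun : Polynomial L → ℝ
  nonneg' : ∀ P, 0 ≤ toFun P
  map_mul' : ∀ P Q, toFun (P * Q) = toFun P * toFun Q
  add_le' : ∀ P Q, toFun (P + Q) ≤ toFun P + toFun Q
  const' : ∀ a : L, toFun (C a) = ‖a‖

namespace BerkovichPoint

variable {L : Type*} [NontriviallyNormedField L]

/-- The topology of pointwise convergence on the Berkovich affine line. -/
instance : TopologicalSpace (BerkovichPoint L) :=
  TopologicalSpace.induced (fun x => x.toFun) Pi.topologicalSpace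

/-- The Gauss norm of a polynomial: the maximum of the absolute values of its coefficients.
The Gauss point `ζ_G` is the point of the Berkovich affine line given by this seminorm. -/
noncomputable def gaussNorm (P : Polynomial L) : ℝ := ⨆ i : ℕ, ‖P.coeff i‖

/-- The type 1 (evaluation) point of the Berkovich affine line attached to `a ∈ L`:
`ev_a(P) = ‖P(a)‖`. -/
noncomputable def evPoint (a : L) : BerkovichPoint L where
  toFun P := ‖P.eval a‖
  nonneg' P := norm_nonneg _
  map_mul' P Q := by simp
  add_le' P Q := by simp only [eval_add]; exact norm_add_le _ _
  const' b := by simp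

/-- The action of a polynomial `φ` on the Berkovich affine line by pushforward:
`(φ_* x)(P) = x(P ∘ φ)`.  The fixed point locus of `φ` is `{x | pushforward φ x = x}`. -/
noncomputable def pushforward (φ : Polynomial L) (x : BerkovichPoint L) : BerkovichPoint L where
  toFun P := x.toFun (P.comp φ)
  nonneg' P := x.nonneg' _
  map_mul' P Q := by simp only [mul_comp]; exact x.map_mul' _ _
  add_le' P Q := by simp only [add_comp]; exact x.add_le' _ _
  const' a := by simp only [C_comp]; exact x.const' a

end BerkovichPoint

open BerkovichPoint

namespace BerkovichPoint

variable {L : Type*} [NontriviallyNormedField L]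

theorem toFun_injective : Function.Injective (toFun : BerkovichPoint L → Polynomial L → ℝ) := by
  rintro ⟨f, _, _, _, _⟩ ⟨g, _, _, _, _⟩ h
  cases h
  rfl

theorem toFun_pow (x : BerkovichPoint L) (P : Polynomial L) (n : ℕ) :
    x.toFun (P ^ n) = x.toFun P ^ n := by
  induction n with
  | zero => simpa using x.const' 1
  | succ n ih => rw [pow_succ, x.map_mul', ih, pow_succ]

/-- Any point at which `X - a` vanishes is the evaluation point at `a`. -/
theorem eq_evPoint_of_toFun_X_sub_C_eq_zero {x : BerkovichPoint L} {a : L}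
    (h : x.toFun (X - C a) = 0) : x = evPoint a := by
  have hmul (Q : Polynomial L) : x.toFun ((X - C a) * Q) = 0 := by
    rw [x.map_mul', h, zero_mul]
  refine toFun_injective (funext fun P => ?_)
  change x.toFun P = ‖P.eval a‖
  obtain ⟨Q, hQ⟩ := X_sub_C_dvd_sub_C_eval (a := a) (p := P)
  refine le_antisymm ?_ ?_
  · have hle := x.add_le' (C (P.eval a)) ((X - C a) * Q)
    rwa [← hQ, add_sub_cancel, hQ, hmul, x.const', add_zero] at hle
  · have hle := x.add_le' P ((X - C a) * -Q)
    rwa [hmul, mul_neg, ← hQ, ← sub_eq_add_neg, sub_sub_cancel, x.const', add_zero] at hle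

end BerkovichPoint

/-- Polynomial case of Lemma 3.9: for `φ(X) = a + u·(X − a)^d` with `‖u‖ = 1`, `a ∈ O_L` and
`d ≥ 2` (a degree-`d` polynomial with good reduction, totally ramified at its fixed point
`a`), the evaluation point `ev_a` is fixed by `φ` and is the unique fixed point of `φ` in
the open Berkovich disk of the direction of `a` at the Gauss point. -/
theorem totally_ramified_fixed_point_unique_in_direction
    (L : Type*) [NontriviallyNormedField L] [CompleteSpace L] [IsAlgClosed L] [CharZero L]
    (hna : IsNonarchimedean (fun x : L => ‖x‖))
    (d : ℕ) (hd : 2 ≤ d) (a u : L) (ha : ‖a‖ ≤ 1) (hu : ‖u‖ = 1) :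
    pushforward (C a + C u * (X - C a) ^ d) (evPoint a) = evPoint a ∧
    ∀ x : BerkovichPoint L, pushforward (C a + C u * (X - C a) ^ d) x = x →
      x.toFun (X - C a) < 1 → x = evPoint a := by
  refine ⟨toFun_injective (funext fun P => ?_), fun x hx hlt => ?_⟩
  · have hd0 : d ≠ 0 := by omega
    simp [pushforward, evPoint, eval_comp, hd0]
  · apply eq_evPoint_of_toFun_X_sub_C_eq_zero
    have hfix : x.toFun ((X - C a).comp (C a + C u * (X - C a) ^ d)) = x.toFun (X - C a) :=
      congrFun (congrArg toFun hx) (X - C a)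
    rw [sub_comp, X_comp, C_comp, add_sub_cancel_left, x.map_mul', x.const', hu, one_mul,
      toFun_pow] at hfix
    by_contra hne
    have hpos : 0 < x.toFun (X - C a) := lt_of_le_of_ne (x.nonneg' _) (Ne.symm hne)
    exact (pow_lt_self_of_lt_one₀ hpos hlt hd).ne hfix
end

section
/- (Arc of fixed points in a residually non-critical fixed direction; key step in the proof of Theorem 3.2.) Let φ ∈ O_L[X] be a polynomial of degree d ≥ 2 with good reduction, and let c ∈ O_L be such that its residue c̄ ∈ k satisfies φ̃(c̄) = c̄ and φ̃'(c̄) ≠ 0. If x ∈ Fix(φ) satisfies x(X − c) < 1, then every multiplicative seminorm y ∈ A¹_an with x(P) ≤ y(P) ≤ ζ_G(P) for all P ∈ L[X] (i.e. every point on the arc from x to the Gauss point) also belongs to Fix(φ). In particular x lies in the connected component of Fix(φ) containing ζ_G. -/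
open Polynomial

open BerkovichPoint

namespace BerkovichPoint

section Basic

variable {L : Type*} [NontriviallyNormedField L]

@[ext]
theorem ext {x y : BerkovichPoint L} (h : ∀ P, x.toFun P = y.toFun P) : x = y := by
  obtain ⟨f, _, _, _, _⟩ := x
  obtain ⟨g, _, _, _, _⟩ := y
  obtain rfl : f = g := funext h
  rfl

variable (x : BerkovichPoint L)

theorem map_zero : x.toFun 0 = 0 := by
  simpa using x.const' 0

theorem map_one : x.toFun 1 = 1 := by
  simpa using x.const' 1

/-- A point of the Berkovich affine line as a homomorphism of multiplicative monoids. -/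
def toMonoidHom : L[X] →* ℝ where
  toFun := x.toFun
  map_one' := x.map_one
  map_mul' := x.map_mul'

theorem map_pow (P : L[X]) (n : ℕ) : x.toFun (P ^ n) = x.toFun P ^ n :=
  _root_.map_pow x.toMonoidHom P n

theorem map_neg (P : L[X]) : x.toFun (-P) = x.toFun P := by
  have h : -P = C (-1) * P := by simp
  rw [h, x.map_mul', x.const']
  simp

theorem sum_le {ι : Type*} (s : Finset ι) (f : ι → L[X]) :
    x.toFun (∑ i ∈ s, f i) ≤ ∑ i ∈ s, x.toFun (f i) :=
  Finset.le_sum_of_subadditive x.toFun x.map_zero.le x.add_le' s f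

theorem natCast_le_one (hna : IsNonarchimedean (fun a : L => ‖a‖)) (n : ℕ) :
    x.toFun (n : L[X]) ≤ 1 := by
  have := IsUltrametricDist.isUltrametricDist_of_isNonarchimedean_norm hna
  rw [← C_eq_natCast, x.const']
  exact IsUltrametricDist.norm_natCast_le_one L n

/-- Over a nonarchimedean field every point of the Berkovich line is nonarchimedean. -/
theorem isNonarchimedean (hna : IsNonarchimedean (fun a : L => ‖a‖)) :
    IsNonarchimedean x.toFun := by
  intro P Q
  set M := max (x.toFun P) (x.toFun Q) with hM
  have hM0 : 0 ≤ M := (x.nonneg' P).trans (le_max_left _ _)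
  have key (n : ℕ) : x.toFun (P + Q) ^ n ≤ (n + 1) * M ^ n := by
    rw [← x.map_pow, add_pow]
    calc x.toFun (∑ m ∈ Finset.range (n + 1), P ^ m * Q ^ (n - m) * (n.choose m : L[X]))
        ≤ ∑ m ∈ Finset.range (n + 1), x.toFun (P ^ m * Q ^ (n - m) * (n.choose m : L[X])) :=
          x.sum_le _ _
      _ ≤ ∑ m ∈ Finset.range (n + 1), M ^ n := by
          refine Finset.sum_le_sum fun m hm => ?_
          have hmn : m + (n - m) = n := by
            have := Finset.mem_range.1 hm
            omega
          rw [x.map_mul', x.map_mul', x.map_pow, x.map_pow]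
          calc x.toFun P ^ m * x.toFun Q ^ (n - m) * x.toFun (n.choose m : L[X])
              ≤ M ^ m * M ^ (n - m) * 1 := by
                have hP := x.nonneg' P
                have hQ := x.nonneg' Q
                have hN := x.nonneg' (n.choose m : L[X])
                gcongr
                · exact le_max_left _ _
                · exact le_max_right _ _
                · exact x.natCast_le_one hna _
            _ = M ^ n := by rw [mul_one, ← pow_add, hmn]
      _ = (n + 1) * M ^ n := by simp
  by_contra! hlt
  rcases hM0.eq_or_lt with h0 | hpos
  · have := key 1
    simp only [pow_one, ← h0, mul_zero] at this
    exact absurd (h0.symm ▸ hlt) (not_lt.2 this)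
  · have ht : 1 < x.toFun (P + Q) / M := (one_lt_div hpos).2 hlt
    have hbd (n : ℕ) : 1 ≤ ((n : ℝ) ^ 1 + 1) / (x.toFun (P + Q) / M) ^ n := by
      rw [le_div_iff₀ (by positivity), one_mul, div_pow, div_le_iff₀ (by positivity), pow_one]
      exact key n
    have h1 := tendsto_pow_const_div_const_pow_of_one_lt 1 ht
    have h2 := tendsto_pow_const_div_const_pow_of_one_lt 0 ht
    have h3 := h1.add h2
    simp only [← add_div, pow_zero, add_zero] at h3
    exact absurd (ge_of_tendsto' h3 hbd) (by norm_num)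

end Basic

section Nonarchimedean

variable {L : Type*} [NontriviallyNormedField L] (hna : IsNonarchimedean (fun a : L => ‖a‖))
  (x : BerkovichPoint L)

include hna

theorem sub_le_max (P Q : L[X]) : x.toFun (P - Q) ≤ max (x.toFun P) (x.toFun Q) := by
  rw [sub_eq_add_neg, ← x.map_neg Q]
  exact x.isNonarchimedean hna _ _

theorem norm_sub_le_max (a b : L) :
    ‖a - b‖ ≤ max (x.toFun (X - C a)) (x.toFun (X - C b)) := by
  rw [← x.const' (a - b), max_comm]
  convert x.sub_le_max hna (X - C b) (X - C a) using 2
  simp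

theorem apply_X_sub_C_le_max (a b : L) :
    x.toFun (X - C b) ≤ max (x.toFun (X - C a)) ‖a - b‖ := by
  have h : (X - C b : L[X]) = X - C a + C (a - b) := by simp
  rw [← x.const' (a - b), h]
  exact x.isNonarchimedean hna _ _

/-- An integral polynomial does not increase distances on the closed unit disc. -/
theorem apply_sub_C_eval_le (hX : x.toFun X ≤ 1) {P : L[X]} (hP : ∀ i, ‖P.coeff i‖ ≤ 1)
    {a : L} (ha : ‖a‖ ≤ 1) : x.toFun (P - C (P.eval a)) ≤ x.toFun (X - C a) := by
  have hpow (n : ℕ) : x.toFun (X ^ n - C (a ^ n)) ≤ x.toFun (X - C a) := by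
    induction n with
    | zero => simpa [x.map_zero] using x.nonneg' _
    | succ n ih =>
      have h : (X ^ (n + 1) - C (a ^ (n + 1)) : L[X]) =
          X * (X ^ n - C (a ^ n)) + C (a ^ n) * (X - C a) := by
        simp only [C_pow]
        ring
      rw [h]
      refine (x.isNonarchimedean hna _ _).trans (max_le ?_ ?_)
      · rw [x.map_mul']
        exact (mul_le_of_le_one_left (x.nonneg' _) hX).trans ih
      · rw [x.map_mul', x.const', norm_pow]
        exact mul_le_of_le_one_left (x.nonneg' _) (pow_le_one₀ (norm_nonneg _) ha)
  have h : P - C (P.eval a) =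
      ∑ i ∈ Finset.range (P.natDegree + 1), C (P.coeff i) * (X ^ i - C (a ^ i)) := by
    simp only [mul_sub, Finset.sum_sub_distrib]
    rw [← P.as_sum_range_C_mul_X_pow, eval_eq_sum_range]
    simp only [map_sum, C_mul]
  rw [h]
  obtain ⟨i, -, hi⟩ := (x.isNonarchimedean hna).finset_image_add_of_nonempty
    (fun i => C (P.coeff i) * (X ^ i - C (a ^ i)))
    (Finset.nonempty_range_add_one (n := P.natDegree))
  refine hi.trans ?_
  rw [x.map_mul', x.const']
  exact (mul_le_of_le_one_left (x.nonneg' _) (hP i)).trans (hpow i)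

end Nonarchimedean

section Disc

variable {L : Type*} [NontriviallyNormedField L] (hna : IsNonarchimedean (fun a : L => ‖a‖))

/-- The point `ζ_{a,r}` of the Berkovich line: the supremum seminorm on the closed disc with
centre `a` and radius `r > 0`. -/
noncomputable def discPoint (a : L) (r : ℝ) (hr : 0 < r) : BerkovichPoint L where
  toFun P := (P.comp (X + C a)).gaussNorm (NormedField.toAbsoluteValue L) r
  nonneg' P := Polynomial.gaussNorm_nonneg _ _ hr.le
  map_mul' P Q := by
    rw [mul_comp]
    exact Polynomial.gaussNorm_mul hna hr _ _
  add_le' P Q := by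
    rw [add_comp]
    exact (Polynomial.isNonarchimedean_gaussNorm _ hna hr.le).add_le
      fun R => Polynomial.gaussNorm_nonneg _ R hr.le
  const' b := by
    rw [C_comp, Polynomial.gaussNorm_C]
    rfl

theorem norm_eval_le_discPoint (a : L) (r : ℝ) (hr : 0 < r) (P : L[X]) :
    ‖P.eval a‖ ≤ (discPoint hna a r hr).toFun P := by
  refine le_of_eq_of_le ?_
    (Polynomial.le_gaussNorm (NormedField.toAbsoluteValue L) (P.comp (X + C a)) hr.le 0)
  rw [← taylor_apply, taylor_coeff_zero, pow_zero, mul_one]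
  rfl

theorem norm_eval_derivative_mul_le_discPoint (a : L) (r : ℝ) (hr : 0 < r) (P : L[X]) :
    ‖(derivative P).eval a‖ * r ≤ (discPoint hna a r hr).toFun P := by
  refine le_of_eq_of_le ?_
    (Polynomial.le_gaussNorm (NormedField.toAbsoluteValue L) (P.comp (X + C a)) hr.le 1)
  rw [← taylor_apply, taylor_coeff_one, pow_one]
  rfl

theorem discPoint_X_sub_C (a : L) (r : ℝ) (hr : 0 < r) (b : L) :
    (discPoint hna a r hr).toFun (X - C b) = max r ‖a - b‖ := by
  have hself : (discPoint hna a r hr).toFun (X - C a) = r := by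
    have h : ((X - C a : L[X]).comp (X + C a)) = monomial 1 1 := by
      simp [← X_pow_eq_monomial]
    simp only [discPoint, h, Polynomial.gaussNorm_monomial]
    simp
  apply le_antisymm
  · exact ((discPoint hna a r hr).apply_X_sub_C_le_max hna a b).trans_eq (by rw [hself])
  · apply max_le
    · refine le_of_eq_of_le ?_ (norm_eval_derivative_mul_le_discPoint hna a r hr (X - C b))
      simp
    · refine le_of_eq_of_le ?_ (norm_eval_le_discPoint hna a r hr (X - C b))
      simp

theorem discPoint_zero_one (P : L[X]) :
    (discPoint hna 0 1 one_pos).toFun P = gaussNorm P := by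
  simp only [discPoint, C_0, add_zero, comp_X]
  rw [← Polynomial.gaussNorm_coe_powerSeries _ _ zero_le_one, PowerSeries.gaussNorm_eq]
  simp only [gaussNorm, one_pow, mul_one, coeff_coe]
  rfl

include hna in
/-- The point obtained from `x` by raising all radii to at least `s`. -/
theorem exists_apply_X_sub_C_eq_max (x : BerkovichPoint L) (s : ℝ) :
    ∃ z : BerkovichPoint L, ∀ a, z.toFun (X - C a) = max (x.toFun (X - C a)) s := by
  by_cases h : ∃ a, x.toFun (X - C a) < s
  · obtain ⟨a, ha⟩ := h
    refine ⟨discPoint hna a s ((x.nonneg' _).trans_lt ha), fun b => ?_⟩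
    rw [discPoint_X_sub_C]
    have h1 := x.norm_sub_le_max hna a b
    have h2 := x.apply_X_sub_C_le_max hna a b
    grind
  · push Not at h
    exact ⟨x, fun a => (max_eq_left (h a)).symm⟩

end Disc

section AlgClosed

variable {L : Type*} [NontriviallyNormedField L] [IsAlgClosed L]

theorem apply_eq_prod_roots (x : BerkovichPoint L) (P : L[X]) :
    x.toFun P = ‖P.leadingCoeff‖ * (P.roots.map fun a => x.toFun (X - C a)).prod := by
  conv_lhs => rw [(IsAlgClosed.splits P).eq_prod_roots]
  rw [x.map_mul', x.const']
  congr 1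
  exact (map_multiset_prod x.toMonoidHom _).trans (by rw [Multiset.map_map]; rfl)

theorem le_of_forall_X_sub_C {x y : BerkovichPoint L}
    (h : ∀ a, x.toFun (X - C a) ≤ y.toFun (X - C a)) (P : L[X]) : x.toFun P ≤ y.toFun P := by
  rw [x.apply_eq_prod_roots, y.apply_eq_prod_roots]
  exact mul_le_mul_of_nonneg_left
    (Multiset.prod_map_le_prod_map₀ _ _ (fun a _ => x.nonneg' _) fun a _ => h a) (norm_nonneg _)

theorem ext_X_sub_C {x y : BerkovichPoint L}
    (h : ∀ a, x.toFun (X - C a) = y.toFun (X - C a)) : x = y :=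
  ext fun P => le_antisymm (le_of_forall_X_sub_C (fun a => (h a).le) P)
    (le_of_forall_X_sub_C (fun a => (h a).ge) P)

variable (hna : IsNonarchimedean (fun a : L => ‖a‖))

/-- A point strictly above `x` somewhere on linear polynomials is the point of a disc. -/
theorem eq_discPoint_of_lt {x y : BerkovichPoint L} (hxy : ∀ P, x.toFun P ≤ y.toFun P) {a : L}
    (ha : x.toFun (X - C a) < y.toFun (X - C a)) :
    y = discPoint hna a (y.toFun (X - C a)) ((x.nonneg' _).trans_lt ha) := by
  refine ext_X_sub_C fun b => ?_
  rw [discPoint_X_sub_C]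
  refine le_antisymm (y.apply_X_sub_C_le_max hna a b) ?_
  have h1 := x.norm_sub_le_max hna a b
  have h2 := y.apply_X_sub_C_le_max hna b a
  rw [norm_sub_rev] at h2
  have h3 := hxy (X - C b)
  grind

theorem continuous_of_apply_X_sub_C_eq_max (x : BerkovichPoint L) {γ : ℝ → BerkovichPoint L}
    (hγ : ∀ s a, (γ s).toFun (X - C a) = max (x.toFun (X - C a)) s) : Continuous γ := by
  refine continuous_induced_rng.2 (continuous_pi fun P => ?_)
  have h : (fun s => (γ s).toFun P) =
      fun s => ‖P.leadingCoeff‖ * (P.roots.map fun a => max (x.toFun (X - C a)) s).prod := by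
    funext s
    simp only [(γ s).apply_eq_prod_roots P, hγ]
  change Continuous fun s => (γ s).toFun P
  rw [h]
  exact continuous_const.mul
    (continuous_multiset_prod _ fun a _ => continuous_const.max continuous_id)

include hna in
theorem pushforward_eq_self_of_between {φ : L[X]} (hcoeff : ∀ i, ‖φ.coeff i‖ ≤ 1)
    {c : L} (hc : ‖c‖ ≤ 1) (hnoncrit : ‖(derivative φ).eval c‖ = 1)
    {x : BerkovichPoint L} (hx : pushforward φ x = x) (hxc : x.toFun (X - C c) < 1)
    {y : BerkovichPoint L} (hxy : ∀ P, x.toFun P ≤ y.toFun P) (hyX : y.toFun X ≤ 1) :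
    pushforward φ y = y := by
  have := IsUltrametricDist.isUltrametricDist_of_isNonarchimedean_norm hna
  by_cases h : ∃ a, x.toFun (X - C a) < y.toFun (X - C a)
  swap
  · push Not at h
    obtain rfl : x = y := ext_X_sub_C fun a => le_antisymm (hxy _) (h a)
    exact hx
  obtain ⟨a, ha⟩ := h
  have hxX : x.toFun X ≤ 1 := (hxy X).trans hyX
  have ha1 : ‖a‖ ≤ 1 := by
    have h1 := x.norm_sub_le_max hna a 0
    have h2 := y.apply_X_sub_C_le_max hna 0 a
    simp only [C_0, sub_zero, zero_sub, norm_neg] at h1 h2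
    grind
  have hr1 : y.toFun (X - C a) ≤ 1 := by
    have h2 := y.sub_le_max hna X (C a)
    rw [y.const'] at h2
    grind
  have hac : ‖a - c‖ < 1 := (x.norm_sub_le_max hna a c).trans_lt (max_lt (ha.trans_le hr1) hxc)
  have hder : ‖(derivative φ).eval a‖ = 1 := by
    have hd (i : ℕ) : ‖(derivative φ).coeff i‖ ≤ 1 := by
      rw [coeff_derivative, norm_mul]
      refine mul_le_one₀ (hcoeff _) (norm_nonneg _) ?_
      exact_mod_cast IsUltrametricDist.norm_natCast_le_one L (i + 1)
    have hlt : ‖(derivative φ).eval a - (derivative φ).eval c‖ < 1 := by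
      refine lt_of_le_of_lt ?_ hac
      simpa [evPoint] using (evPoint a).apply_sub_C_eval_le hna (by simpa [evPoint] using ha1) hd hc
    have h1 := IsUltrametricDist.norm_add_eq_max_of_norm_ne_norm
      (x := (derivative φ).eval a - (derivative φ).eval c) (y := (derivative φ).eval c)
      (by rw [hnoncrit]; exact hlt.ne)
    rw [sub_add_cancel, hnoncrit, max_eq_right hlt.le] at h1
    exact h1
  have hmove : ‖φ.eval a - a‖ < y.toFun (X - C a) := by
    have h1 : x.toFun (X - C (φ.eval a)) = x.toFun (φ - C (φ.eval a)) := by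
      conv_lhs => rw [← hx]
      simp [pushforward]
    have h2 := x.apply_sub_C_eval_le hna hxX hcoeff ha1
    have h3 := x.norm_sub_le_max hna (φ.eval a) a
    grind
  refine ext_X_sub_C fun b => ?_
  have hy := eq_discPoint_of_lt hna hxy ha
  have hyb : y.toFun (X - C b) = max (y.toFun (X - C a)) ‖a - b‖ := by
    conv_lhs => rw [hy]
    exact discPoint_X_sub_C hna _ _ _ b
  have hup := y.isNonarchimedean hna (φ - C (φ.eval a)) (C (φ.eval a - b))
  have hup' := y.apply_sub_C_eval_le hna hyX hcoeff ha1
  have hlow0 := norm_eval_le_discPoint hna a _ ((x.nonneg' _).trans_lt ha) (φ - C b)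
  have hlow1 := norm_eval_derivative_mul_le_discPoint hna a _ ((x.nonneg' _).trans_lt ha) (φ - C b)
  rw [← hy] at hlow0 hlow1
  have hsum : φ - C (φ.eval a) + C (φ.eval a - b) = φ - C b := by
    rw [C_sub]
    ring
  rw [hsum, y.const'] at hup
  simp only [derivative_sub, derivative_C, sub_zero, hder, one_mul, eval_sub, eval_C]
    at hlow0 hlow1
  have hpush : (pushforward φ y).toFun (X - C b) = y.toFun (φ - C b) := by
    simp [pushforward]
  have h1 := hna (φ.eval a - a) (a - b)
  have h2 := hna (a - φ.eval a) (φ.eval a - b)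
  simp only [sub_add_sub_cancel] at h1 h2
  rw [norm_sub_rev a (φ.eval a)] at h2
  rw [hpush, hyb]
  grind

end AlgClosed

end BerkovichPoint

/-- Arc of fixed points in a residually non-critical fixed direction (key step in the proof
of Theorem 3.2): if `φ` has good reduction, `c ∈ O_L` reduces to a fixed non-critical point
of `φ̃` (i.e. `‖φ(c) − c‖ < 1` and `‖φ'(c)‖ = 1`), and `x` is a Berkovich fixed point of `φ`
with `x(X − c) < 1`, then every point `y` on the arc from `x` to the Gauss point (i.e. with
`x(P) ≤ y(P) ≤ ζ_G(P)` for all `P`) is fixed by `φ`; in particular `x` lies in the connected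
component of the fixed point locus containing the Gauss point `ζ_G`. -/
theorem arc_of_fixed_points_in_noncritical_fixed_direction
    (L : Type*) [NontriviallyNormedField L] [CompleteSpace L] [IsAlgClosed L] [CharZero L]
    (hna : IsNonarchimedean (fun x : L => ‖x‖))
    (φ : L[X]) (d : ℕ) (hd : 2 ≤ d) (hdeg : φ.natDegree = d)
    (hcoeff : ∀ i, ‖φ.coeff i‖ ≤ 1) (hlead : ‖φ.leadingCoeff‖ = 1)
    (c : L) (hc : ‖c‖ ≤ 1)
    (hfix : ‖φ.eval c - c‖ < 1) (hnoncrit : ‖(derivative φ).eval c‖ = 1)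
    (ζG : BerkovichPoint L) (hζG : ∀ P : L[X], ζG.toFun P = gaussNorm P)
    (x : BerkovichPoint L) (hx : pushforward φ x = x) (hxc : x.toFun (X - C c) < 1) :
    (∀ y : BerkovichPoint L,
        (∀ P : L[X], x.toFun P ≤ y.toFun P ∧ y.toFun P ≤ gaussNorm P) →
        pushforward φ y = y) ∧
    x ∈ connectedComponentIn {z : BerkovichPoint L | pushforward φ z = z} ζG := by
  have hfixed (y : BerkovichPoint L) (hxy : ∀ P, x.toFun P ≤ y.toFun P) (hyX : y.toFun X ≤ 1) :
      pushforward φ y = y :=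
    pushforward_eq_self_of_between hna hcoeff hc hnoncrit hx hxc hxy hyX
  have hζlin (a : L) : ζG.toFun (X - C a) = max 1 ‖a‖ := by
    rw [hζG, ← discPoint_zero_one hna, discPoint_X_sub_C, zero_sub, norm_neg]
  have hζX : ζG.toFun X = 1 := by simpa using hζlin 0
  refine ⟨fun y hy => hfixed y (fun P => (hy P).1)
    (((hy X).2.trans_eq (hζG X).symm).trans_eq hζX), ?_⟩
  choose γ hγ using exists_apply_X_sub_C_eq_max hna x
  have hxX : x.toFun X ≤ 1 := by
    have h := x.apply_X_sub_C_le_max hna c 0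
    simp only [C_0, sub_zero] at h
    exact h.trans (max_le hxc.le hc)
  have hγ0 : γ 0 = x := ext_X_sub_C fun a => by rw [hγ, max_eq_left (x.nonneg' _)]
  have hγ1 : γ 1 = ζG := by
    refine ext_X_sub_C fun a => ?_
    rw [hγ, hζlin]
    have h1 := x.norm_sub_le_max hna a 0
    have h2 := x.apply_X_sub_C_le_max hna 0 a
    simp only [C_0, sub_zero, zero_sub, norm_neg] at h1 h2
    grind
  have hsub : γ '' Set.Icc 0 1 ⊆ {z : BerkovichPoint L | pushforward φ z = z} := by
    rintro _ ⟨s, hs, rfl⟩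
    refine hfixed _ (le_of_forall_X_sub_C fun a => (hγ s a).symm ▸ le_max_left _ _) ?_
    have h := hγ s 0
    simp only [C_0, sub_zero] at h
    rw [h]
    exact max_le hxX hs.2
  have hconn : IsPreconnected (γ '' Set.Icc 0 1) :=
    isPreconnected_Icc.image γ (continuous_of_apply_X_sub_C_eq_max x hγ).continuousOn
  exact hconn.subset_connectedComponentIn ⟨1, by simp, hγ1⟩ hsub ⟨0, by simp, hγ0⟩
end
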